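/- Let S^n (n ≥ 1) denote the boundary of the directed cube I⃗^{n+1}, i.e. the boundary of [0,1]^{n+1} ⊂ ℝ^{n+1} with the d-structure consisting of all paths that are non-decreasing in each coordinate, and with the origin as initial point. Then the directed LS category of this directed sphere equals 2: vcat(S^n) = 2. -/

import Mathlib

open unitInterval Set Topology

noncomputable section

/-- Concatenation of two continuous maps from the unit interval, when the endpoint of the
first is the starting point of the second. -/
def concatCM {X : Type*} [TopologicalSpace X] (γ δ : C(I, X)) (h : γ 1 = δ 0) : C(I, X) :=
  ((⟨γ, rfl, rfl⟩ : Path (γ 0) (γ 1)).trans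
    ((⟨δ, rfl, rfl⟩ : Path (δ 0) (δ 1)).cast h rfl)).toContinuousMap

lemma concatCM_apply {X : Type*} [TopologicalSpace X] (γ δ : C(I, X)) (h : γ 1 = δ 0) (t : I) :
    concatCM γ δ h t =
      if ht : (t : ℝ) ≤ 1 / 2 then γ ⟨2 * t, (unitInterval.mul_pos_mem_iff two_pos).2 ⟨t.2.1, ht⟩⟩
      else δ ⟨2 * t - 1, unitInterval.two_mul_sub_one_mem_iff.2 ⟨(not_le.1 ht).le, t.2.2⟩⟩ := by
  have := Path.trans_apply (⟨γ, rfl, rfl⟩ : Path (γ 0) (γ 1))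
    ((⟨δ, rfl, rfl⟩ : Path (δ 0) (δ 1)).cast h rfl) t
  simpa [concatCM, Path.cast] using this

@[simp] lemma concatCM_zero {X : Type*} [TopologicalSpace X] (γ δ : C(I, X)) (h : γ 1 = δ 0) :
    concatCM γ δ h 0 = γ 0 := by
  simp [concatCM_apply]

@[simp] lemma concatCM_one {X : Type*} [TopologicalSpace X] (γ δ : C(I, X)) (h : γ 1 = δ 0) :
    concatCM γ δ h 1 = δ 1 := by
  rw [concatCM_apply]
  norm_num

lemma comp_concatCM {X Y : Type*} [TopologicalSpace X] [TopologicalSpace Y]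
    (f : C(X, Y)) (γ δ : C(I, X)) (h : γ 1 = δ 0) :
    f.comp (concatCM γ δ h) =
      concatCM (f.comp γ) (f.comp δ) (by simpa using congrArg f h) := by
  ext t
  simp only [ContinuousMap.comp_apply, concatCM_apply]
  split_ifs <;> rfl

lemma monotone_concatCM {Z : Type*} [TopologicalSpace Z] [Preorder Z] {γ δ : C(I, Z)}
    (h : γ 1 = δ 0) (hγ : Monotone γ) (hδ : Monotone δ) : Monotone ⇑(concatCM γ δ h) := by
  intro s t hst
  have hst' : (s : ℝ) ≤ (t : ℝ) := hst
  rw [concatCM_apply, concatCM_apply]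
  split_ifs with hs ht ht
  · exact hγ (Subtype.mk_le_mk.2 (by linarith))
  · calc γ _ ≤ γ 1 := hγ (unitInterval.le_one _)
      _ = δ 0 := h
      _ ≤ δ _ := hδ (unitInterval.nonneg _)
  · exact absurd (hst'.trans ht) hs
  · exact hδ (Subtype.mk_le_mk.2 (by linarith))

/-- A d-space structure on a topological space: a distinguished set of paths containing the
constant paths, closed under concatenation, and closed under pre-composition with
continuous non-decreasing reparametrizations of the interval. -/
structure DStruct (X : Type*) [TopologicalSpace X] where
  paths : Set C(I, X)
  const_mem : ∀ x : X, ContinuousMap.const I x ∈ paths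
  concat_mem : ∀ γ ∈ paths, ∀ δ ∈ paths, ∀ h : γ 1 = δ 0, concatCM γ δ h ∈ paths
  reparam_mem : ∀ γ ∈ paths, ∀ φ : C(I, I), Monotone φ → γ.comp φ ∈ paths

variable {X : Type*} [TopologicalSpace X] {Y : Type*} [TopologicalSpace Y]

/-- The set `Γ_X` of pairs of points joined by a directed path. -/
def dGamma (dX : DStruct X) : Set (X × X) :=
  {q | ∃ γ ∈ dX.paths, γ 0 = q.1 ∧ γ 1 = q.2}

/-- The set `dX(x, x')` of directed paths from `x` to `x'`. -/
def dBetween (dX : DStruct X) (x x' : X) : Set C(I, X) :=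
  {γ | γ ∈ dX.paths ∧ γ 0 = x ∧ γ 1 = x'}

/-- An initial point of a d-space: a point from which there is a directed path to any point. -/
def IsInitialPoint (dX : DStruct X) (x₀ : X) : Prop := ∀ x : X, (x₀, x) ∈ dGamma dX

/-- A d-space is strongly connected if any ordered pair of points is joined by a d-path. -/
def StronglyConnected (dX : DStruct X) : Prop := dGamma dX = Set.univ

/-- A space is a Euclidean Neighbourhood Retract if it embeds in some Euclidean space as a
retract of an open neighbourhood of itself. -/
def IsENR (A : Type*) [TopologicalSpace A] : Prop :=
  ∃ (N : ℕ) (e : A → (Fin N → ℝ)), IsEmbedding e ∧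
    ∃ U : Set (Fin N → ℝ), IsOpen U ∧ Set.range e ⊆ U ∧
      ∃ r : U → A, Continuous r ∧ ∀ (a : A) (h : e a ∈ U), r ⟨e a, h⟩ = a

/-- A subset of a space is an ENR if the corresponding subspace is an ENR. -/
def IsENRSet {Z : Type*} [TopologicalSpace Z] (A : Set Z) : Prop := IsENR A

/-- A subset of `X × X` admits a continuous section of the directed endpoint map
`π⃗ : dX → Γ_X`. -/
def DSecSet (dX : DStruct X) (U : Set (X × X)) : Prop :=
  ∃ s : U → C(I, X), Continuous s ∧
    ∀ u : U, s u ∈ dX.paths ∧ (s u) 0 = u.1.1 ∧ (s u) 1 = u.1.2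

/-- The directed topological complexity of a d-space: the smallest number of ENRs covering
`Γ_X`, each admitting a continuous section of the directed endpoint map. -/
def vTC (dX : DStruct X) : ℕ∞ :=
  sInf {n : ℕ∞ | ∃ m : ℕ, n = (m : ℕ∞) ∧ ∃ U : Fin m → Set (X × X),
    (∀ i, IsENRSet (U i) ∧ DSecSet dX (U i)) ∧ dGamma dX ⊆ ⋃ i, U i}

/-- A subset of `X` admits a continuous section of the evaluation map
`e_X : d₀X → X`, `γ ↦ γ(1)`, where `d₀X` is the space of d-paths starting at `x₀`. -/
def CatSecSet (dX : DStruct X) (x₀ : X) (U : Set X) : Prop :=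
  ∃ s : U → C(I, X), Continuous s ∧
    ∀ u : U, s u ∈ dX.paths ∧ (s u) 0 = x₀ ∧ (s u) 1 = (u : X)

/-- The directed Lusternik–Schnirelmann category of a d-space with initial point `x₀`:
the smallest number of ENRs covering `X`, each admitting a continuous section of the
evaluation map `e_X : d₀X → X`. -/
def vcat (dX : DStruct X) (x₀ : X) : ℕ∞ :=
  sInf {n : ℕ∞ | ∃ m : ℕ, n = (m : ℕ∞) ∧ ∃ U : Fin m → Set X,
    (∀ i, IsENRSet (U i) ∧ CatSecSet dX x₀ (U i)) ∧ ∀ x : X, ∃ i, x ∈ U i}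

/-- A subset of `X × X` admits a continuous section of the free path space fibration. -/
def SecSet (X : Type*) [TopologicalSpace X] (U : Set (X × X)) : Prop :=
  ∃ s : U → C(I, X), Continuous s ∧ ∀ u : U, (s u) 0 = u.1.1 ∧ (s u) 1 = u.1.2

/-- The (Farber) topological complexity of a space, unnormalized convention. -/
def farberTC (X : Type*) [TopologicalSpace X] : ℕ∞ :=
  sInf {n : ℕ∞ | ∃ m : ℕ, n = (m : ℕ∞) ∧ ∃ U : Fin m → Set (X × X),
    (∀ i, IsOpen (U i) ∧ SecSet X (U i)) ∧ ∀ q : X × X, ∃ i, q ∈ U i}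

/-- The inclusion of a subset `U ⊆ X` is nullhomotopic. -/
def NullhomotopicIncl {Z : Type*} [TopologicalSpace Z] (U : Set Z) : Prop :=
  ∃ z₀ : Z, ContinuousMap.Homotopic
    (⟨Subtype.val, continuous_subtype_val⟩ : C(U, Z)) (ContinuousMap.const U z₀)

/-- The Lusternik–Schnirelmann category, unnormalized convention (`cat(point) = 1`). -/
def cat (X : Type*) [TopologicalSpace X] : ℕ∞ :=
  sInf {n : ℕ∞ | ∃ m : ℕ, n = (m : ℕ∞) ∧ ∃ U : Fin m → Set X,
    (∀ i, IsOpen (U i) ∧ NullhomotopicIncl (U i)) ∧ ∀ x : X, ∃ i, x ∈ U i}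

/-- A continuous map is a d-map if it takes d-paths to d-paths. -/
def IsDMap (dX : DStruct X) (dY : DStruct Y) (f : C(X, Y)) : Prop :=
  ∀ γ ∈ dX.paths, f.comp γ ∈ dY.paths

/-- A d-homotopy from `f` to `g`: a continuous homotopy all of whose traces
`t ↦ H(x,t)` are d-paths in the target. -/
def IsDHomotopy (dY : DStruct Y) (f g : C(X, Y)) (H : C(X × I, Y)) : Prop :=
  (∀ x, H (x, 0) = f x) ∧ (∀ x, H (x, 1) = g x) ∧
    ∀ x : X, H.comp ((ContinuousMap.const I x).prodMk (ContinuousMap.id I)) ∈ dY.paths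

/-- Two d-maps are d-homotopic (from `f` to `g`). -/
def DHomotopic (dY : DStruct Y) (f g : C(X, Y)) : Prop :=
  ∃ H : C(X × I, Y), IsDHomotopy dY f g H

/-- A basic dihomotopy equivalence between d-spaces:
d-homotopy inverse d-maps `f, g` together with continuously graded maps `F, G` on the
directed path spaces such that the induced maps on spaces of d-paths between fixed
endpoints are homotopy equivalences. -/
structure BasicDihomotopyEquiv {X : Type*} {Y : Type*} [TopologicalSpace X]
    [TopologicalSpace Y] (dX : DStruct X) (dY : DStruct Y) where
  f : C(X, Y)
  g : C(Y, X)
  f_dmap : IsDMap dX dY f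
  g_dmap : IsDMap dY dX g
  gf_htpy : DHomotopic dX (g.comp f) (ContinuousMap.id X)
  fg_htpy : DHomotopic dY (f.comp g) (ContinuousMap.id Y)
  F : X → X → C(I, Y) → C(I, X)
  F_grade : ∀ x x', (x, x') ∈ dGamma dX →
    ∀ γ ∈ dBetween dY (f x) (f x'), F x x' γ ∈ dBetween dX x x'
  F_cont : Continuous fun q : {q : (X × X) × C(I, Y) //
      q.1 ∈ dGamma dX ∧ q.2 ∈ dBetween dY (f q.1.1) (f q.1.2)} =>
    F q.1.1.1 q.1.1.2 q.1.2
  f_equiv : ∀ x x', (x, x') ∈ dGamma dX →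
    ∃ (Φ : C(↥(dBetween dX x x'), ↥(dBetween dY (f x) (f x'))))
      (Ψ : C(↥(dBetween dY (f x) (f x')), ↥(dBetween dX x x'))),
      (∀ γ, (Φ γ : C(I, Y)) = f.comp (γ : C(I, X))) ∧
      (∀ δ, (Ψ δ : C(I, X)) = F x x' (δ : C(I, Y))) ∧
      (Ψ.comp Φ).Homotopic (ContinuousMap.id _) ∧ (Φ.comp Ψ).Homotopic (ContinuousMap.id _)
  G : Y → Y → C(I, X) → C(I, Y)
  G_grade : ∀ y y', (y, y') ∈ dGamma dY →
    ∀ γ ∈ dBetween dX (g y) (g y'), G y y' γ ∈ dBetween dY y y'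
  G_cont : Continuous fun q : {q : (Y × Y) × C(I, X) //
      q.1 ∈ dGamma dY ∧ q.2 ∈ dBetween dX (g q.1.1) (g q.1.2)} =>
    G q.1.1.1 q.1.1.2 q.1.2
  g_equiv : ∀ y y', (y, y') ∈ dGamma dY →
    ∃ (Φ : C(↥(dBetween dY y y'), ↥(dBetween dX (g y) (g y'))))
      (Ψ : C(↥(dBetween dX (g y) (g y')), ↥(dBetween dY y y'))),
      (∀ γ, (Φ γ : C(I, X)) = g.comp (γ : C(I, Y))) ∧
      (∀ δ, (Ψ δ : C(I, Y)) = G y y' (δ : C(I, X))) ∧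
      (Ψ.comp Φ).Homotopic (ContinuousMap.id _) ∧ (Φ.comp Ψ).Homotopic (ContinuousMap.id _)

/-- The one-point d-space. -/
def unitD : DStruct Unit where
  paths := Set.univ
  const_mem := fun _ => trivial
  concat_mem := fun _ _ _ _ _ => trivial
  reparam_mem := fun _ _ _ _ => trivial

/-- A d-space is dicontractible if it is basic dihomotopy equivalent to a point. -/
def Dicontractible (dX : DStruct X) : Prop := Nonempty (BasicDihomotopyEquiv dX unitD)

/-- Product d-structure: paths whose coordinate projections are d-paths. -/
def DStruct.prod (dX : DStruct X) (dY : DStruct Y) : DStruct (X × Y) where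
  paths := {γ | ContinuousMap.fst.comp γ ∈ dX.paths ∧ ContinuousMap.snd.comp γ ∈ dY.paths}
  const_mem x := by
    constructor
    · have : (ContinuousMap.fst.comp (ContinuousMap.const I x) : C(I, X)) =
        ContinuousMap.const I x.1 := by ext t; rfl
      rw [this]; exact dX.const_mem x.1
    · have : (ContinuousMap.snd.comp (ContinuousMap.const I x) : C(I, Y)) =
        ContinuousMap.const I x.2 := by ext t; rfl
      rw [this]; exact dY.const_mem x.2
  concat_mem γ hγ δ hδ h := by
    constructor
    · rw [comp_concatCM]
      exact dX.concat_mem _ hγ.1 _ hδ.1 _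
    · rw [comp_concatCM]
      exact dY.concat_mem _ hγ.2 _ hδ.2 _
  reparam_mem γ hγ φ hφ := by
    constructor
    · rw [← ContinuousMap.comp_assoc]
      exact dX.reparam_mem _ hγ.1 φ hφ
    · rw [← ContinuousMap.comp_assoc]
      exact dY.reparam_mem _ hγ.2 φ hφ

/-- The continuous inclusion of a subset. -/
def inclCM {Z : Type*} [TopologicalSpace Z] (A : Set Z) : C(↥A, Z) :=
  ⟨Subtype.val, continuous_subtype_val⟩

/-- The d-structure induced on a subspace. -/
def DStruct.restrict (dX : DStruct X) (A : Set X) : DStruct ↥A where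
  paths := {γ | (inclCM A).comp γ ∈ dX.paths}
  const_mem x := by
    have : ((inclCM A).comp (ContinuousMap.const I x) : C(I, X)) =
        ContinuousMap.const I (x : X) := by ext t; rfl
    simpa [Set.mem_setOf_eq, this] using dX.const_mem (x : X)
  concat_mem γ hγ δ hδ h := by
    show (inclCM A).comp _ ∈ dX.paths
    rw [comp_concatCM]
    exact dX.concat_mem _ hγ _ hδ _
  reparam_mem γ hγ φ hφ := by
    show (inclCM A).comp _ ∈ dX.paths
    rw [← ContinuousMap.comp_assoc]
    exact dX.reparam_mem _ hγ φ hφ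

/-- The directed interval `I⃗`: the unit interval with non-decreasing paths. -/
def dInterval : DStruct I where
  paths := {γ | Monotone ⇑γ}
  const_mem x := monotone_const
  concat_mem γ hγ δ hδ h := monotone_concatCM h hγ hδ
  reparam_mem γ hγ φ hφ := hγ.comp hφ

/-- The directed homotopy lifting property of a d-map with respect to every d-space:
a d-fibration. -/
def IsDFibration {E B : Type*} [TopologicalSpace E] [TopologicalSpace B]
    (dE : DStruct E) (dB : DStruct B) (p : C(E, B)) : Prop :=
  IsDMap dE dB p ∧
  ∀ (X : Type) (_ : TopologicalSpace X) (dX : DStruct X) (f : C(X, E)) (φ : C(X × I, B)),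
    IsDMap dX dE f → IsDMap (dX.prod dInterval) dB φ →
    ∀ α : I, (α = 0 ∨ α = 1) → (∀ x, φ (x, α) = p (f x)) →
    ∃ φ' : C(X × I, E), IsDMap (dX.prod dInterval) dE φ' ∧
      (∀ q, p (φ' q) = φ q) ∧ ∀ x, φ' (x, α) = f x

/-- The (Hurewicz) homotopy lifting property with respect to every space: a fibration. -/
def IsFibration {E B : Type*} [TopologicalSpace E] [TopologicalSpace B] (p : C(E, B)) : Prop :=
  ∀ (X : Type) (_ : TopologicalSpace X) (f : C(X, E)) (φ : C(X × I, B)),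
    (∀ x, φ (x, 0) = p (f x)) →
    ∃ φ' : C(X × I, E), (∀ q, p (φ' q) = φ q) ∧ ∀ x, φ' (x, 0) = f x

section Parametrized

variable {E B : Type*} [TopologicalSpace E] [TopologicalSpace B]

/-- The fibre product `E ×_B E`. -/
def EBE (p : C(E, B)) : Set (E × E) := {q | p q.1 = p q.2}

/-- The space `dE_B` of d-paths in `E` lying in a single fibre of `p`. -/
def dEB (dE : DStruct E) (p : C(E, B)) : Set C(I, E) :=
  {γ | γ ∈ dE.paths ∧ ∃ b : B, ∀ t, p (γ t) = b}

/-- The set `Γ_{E,B}` of endpoint pairs of d-paths lying in a single fibre. -/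
def GammaEB (dE : DStruct E) (p : C(E, B)) : Set (E × E) :=
  {q | ∃ γ ∈ dEB dE p, γ 0 = q.1 ∧ γ 1 = q.2}

/-- A subset of `E × E` admits a continuous section of the directed parametrized endpoint
map `Π⃗ : dE_B → Γ_{E,B}`. -/
def DParamSecSet (dE : DStruct E) (p : C(E, B)) (U : Set (E × E)) : Prop :=
  ∃ s : U → C(I, E), Continuous s ∧
    ∀ u : U, s u ∈ dEB dE p ∧ (s u) 0 = u.1.1 ∧ (s u) 1 = u.1.2

/-- The directed parametrized topological complexity of a d-fibration `p : E → B`: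
the smallest number of ENRs covering `Γ_{E,B}`, each admitting a continuous section of
the directed parametrized endpoint map. -/
def vTCp (dE : DStruct E) (p : C(E, B)) : ℕ∞ :=
  sInf {n : ℕ∞ | ∃ m : ℕ, n = (m : ℕ∞) ∧ ∃ U : Fin m → Set (E × E),
    (∀ i, IsENRSet (U i) ∧ DParamSecSet dE p (U i)) ∧ GammaEB dE p ⊆ ⋃ i, U i}

/-- A subset of `E × E` admits a continuous section of the parametrized endpoint map
`Π : E^I_B → E ×_B E`. -/
def ParamSecSet (p : C(E, B)) (U : Set (E × E)) : Prop :=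
  ∃ s : U → C(I, E), Continuous s ∧
    ∀ u : U, (∃ b : B, ∀ t, p ((s u) t) = b) ∧ (s u) 0 = u.1.1 ∧ (s u) 1 = u.1.2

/-- The parametrized topological complexity of a fibration `p : E → B` (Cohen–Farber–
Weinberger): the smallest number of relatively open subsets covering `E ×_B E`, each
admitting a continuous section of the parametrized endpoint map. -/
def TCparam (p : C(E, B)) : ℕ∞ :=
  sInf {n : ℕ∞ | ∃ m : ℕ, n = (m : ℕ∞) ∧ ∃ U : Fin m → Set (E × E),
    (∀ i, U i ⊆ EBE p ∧ IsOpen (Subtype.val ⁻¹' (U i) : Set ↥(EBE p)) ∧ ParamSecSet p (U i)) ∧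
    EBE p ⊆ ⋃ i, U i}

/-- The restriction of `p : E → B` to the preimage of a subset `B' ⊆ B`. -/
def restrictMap (p : C(E, B)) (B' : Set B) : C(↥(p ⁻¹' B'), ↥B') :=
  ⟨fun e => ⟨p e, e.2⟩, by fun_prop⟩

/-- The d-structure `dE_B` on `E` formed by the fibrewise d-paths. -/
def dEBStruct (dE : DStruct E) (p : C(E, B)) : DStruct E where
  paths := dEB dE p
  const_mem x := ⟨dE.const_mem x, ⟨p x, fun _ => rfl⟩⟩
  concat_mem γ hγ δ hδ h := by
    obtain ⟨b, hb⟩ := hγ.2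
    obtain ⟨b', hb'⟩ := hδ.2
    have hbb' : b = b' := by rw [← hb 1, ← hb' 0, h]
    refine ⟨dE.concat_mem _ hγ.1 _ hδ.1 _, ⟨b, fun t => ?_⟩⟩
    rw [concatCM_apply]
    split_ifs
    · exact hb _
    · rw [hbb']; exact hb' _
  reparam_mem γ hγ φ hφ := by
    obtain ⟨b, hb⟩ := hγ.2
    exact ⟨dE.reparam_mem _ hγ.1 φ hφ, ⟨b, fun t => hb (φ t)⟩⟩

/-- The d-structure on the total space associated to a d-structure on the base of a
fibration: a path is directed iff its projection is directed. -/
def assocDStruct (dB : DStruct B) (p : C(E, B)) : DStruct E where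
  paths := {γ | p.comp γ ∈ dB.paths}
  const_mem x := by
    have : (p.comp (ContinuousMap.const I x) : C(I, B)) = ContinuousMap.const I (p x) := by
      ext t; rfl
    simpa [Set.mem_setOf_eq, this] using dB.const_mem (p x)
  concat_mem γ hγ δ hδ h := by
    show p.comp _ ∈ dB.paths
    rw [comp_concatCM]
    exact dB.concat_mem _ hγ _ hδ _
  reparam_mem γ hγ φ hφ := by
    show p.comp _ ∈ dB.paths
    rw [← ContinuousMap.comp_assoc]
    exact dB.reparam_mem _ hγ φ hφ

/-- A d-fibration is d-regular if `Γ_{E,B}` admits a partition realizing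
`vTC[p : E → B]` into pairwise disjoint ENRs with continuous sections whose initial
unions are closed. -/
def IsRegularDFib (dE : DStruct E) (p : C(E, B)) : Prop :=
  ∃ n : ℕ, vTCp dE p = (n : ℕ∞) ∧ ∃ A : Fin n → Set (E × E),
    (∀ i, IsENRSet (A i) ∧ DParamSecSet dE p (A i)) ∧
    (⋃ i, A i) = GammaEB dE p ∧
    (Pairwise fun i j => Disjoint (A i) (A j)) ∧
    ∀ r : Fin n, IsClosed (Subtype.val ⁻¹' (⋃ i, ⋃ (_ : i ≤ r), A i) : Set ↥(GammaEB dE p))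

end Parametrized

/-- A d-space is regular if `Γ_X` admits a partition realizing `vTC(X)` into pairwise
disjoint ENRs with continuous sections whose initial unions are closed. -/
def IsRegularDSpace (dX : DStruct X) : Prop :=
  ∃ n : ℕ, vTC dX = (n : ℕ∞) ∧ ∃ A : Fin n → Set (X × X),
    (∀ i, IsENRSet (A i) ∧ DSecSet dX (A i)) ∧
    (⋃ i, A i) = dGamma dX ∧
    (Pairwise fun i j => Disjoint (A i) (A j)) ∧
    ∀ r : Fin n, IsClosed (Subtype.val ⁻¹' (⋃ i, ⋃ (_ : i ≤ r), A i) : Set ↥(dGamma dX))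

/-- The monotone d-structure on a subset of a (pre)ordered topological space: directed
paths are the paths that are non-decreasing (in each coordinate, for a pi-type order). -/
def monoDStruct {Z : Type*} [TopologicalSpace Z] [Preorder Z] (A : Set Z) : DStruct ↥A where
  paths := {γ | Monotone fun t => ((γ t : Z))}
  const_mem x := fun _ _ _ => le_rfl
  concat_mem γ hγ δ hδ h := by
    have h' : (inclCM A).comp γ 1 = (inclCM A).comp δ 0 := by
      simp [inclCM, h]
    have : Monotone ⇑(concatCM ((inclCM A).comp γ) ((inclCM A).comp δ) h') :=
      monotone_concatCM h' hγ hδ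
    have hcomp := comp_concatCM (inclCM A) γ δ h
    intro s t hst
    have := this hst
    rwa [← hcomp, ContinuousMap.comp_apply, ContinuousMap.comp_apply] at this
  reparam_mem γ hγ φ hφ := hγ.comp hφ

end

lemma zero_mem_frontier_Icc (n : ℕ) :
    (0 : Fin (n + 1) → ℝ) ∈ frontier (Set.Icc (0 : Fin (n + 1) → ℝ) 1) := by
  constructor
  · exact subset_closure (Set.mem_Icc.2 ⟨le_rfl, zero_le_one⟩)
  · intro h
    rw [← Set.pi_univ_Icc, interior_pi_set Set.finite_univ] at h
    have h0 := h (0 : Fin (n + 1)) (Set.mem_univ _)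
    simp only [Pi.zero_apply, Pi.one_apply, interior_Icc, Set.mem_Ioo] at h0
    exact lt_irrefl _ h0.1

/-- A point lies on the boundary of the unit cube iff it lies in the cube and some coordinate
is extremal. -/
lemma mem_frontier_Icc_zero_one_iff {ι : Type*} [Finite ι] {x : ι → ℝ} :
    x ∈ frontier (Icc (0 : ι → ℝ) 1) ↔
      (∀ i, 0 ≤ x i ∧ x i ≤ 1) ∧ ∃ i, x i = 0 ∨ x i = 1 := by
  rw [isClosed_Icc.frontier_eq, ← pi_univ_Icc, interior_pi_set finite_univ]
  simp only [Pi.zero_apply, Pi.one_apply, interior_Icc, mem_sdiff, mem_pi, mem_univ,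
    forall_const, mem_Icc, mem_Ioo, not_forall]
  refine and_congr_right fun h => exists_congr fun i => ?_
  obtain ⟨h0, h1⟩ := h i
  constructor
  · intro h
    by_contra! hne
    exact h ⟨lt_of_le_of_ne h0 hne.1.symm, lt_of_le_of_ne h1 hne.2⟩
  · rintro (h | h) ⟨h', h''⟩ <;> linarith

/-- The boundary of the unit cube is a sphere for the sup norm. -/
lemma frontier_Icc_zero_one_eq_sphere {ι : Type*} [Fintype ι] :
    frontier (Icc (0 : ι → ℝ) 1) = Metric.sphere (fun _ => 1 / 2) (1 / 2) := by
  rw [← frontier_closedBall _ (by norm_num), closedBall_pi _ (by norm_num), ← pi_univ_Icc]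
  simp only [Real.closedBall_eq_Icc]
  norm_num

/-- A subspace of the boundary of the unit cube that is a retract of an open subset of the
ambient Euclidean space is an ENR. -/
lemma isENRSet_of_retraction {N : ℕ} {S : Set (Fin N → ℝ)} {A : Set S} {U : Set (Fin N → ℝ)}
    (hU : IsOpen U) (hAU : ∀ a ∈ A, (a : Fin N → ℝ) ∈ U) (ρ : (Fin N → ℝ) → (Fin N → ℝ))
    (hρ : ContinuousOn ρ U) (hmem : ∀ x ∈ U, ∃ h : ρ x ∈ S, (⟨ρ x, h⟩ : S) ∈ A)
    (hfix : ∀ a ∈ A, ρ a = a) : IsENRSet A := by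
  refine ⟨N, fun a => a.1.1, IsEmbedding.subtypeVal.comp IsEmbedding.subtypeVal, U, hU, ?_,
    fun x => ⟨⟨ρ x, (hmem x x.2).1⟩, (hmem x x.2).2⟩, ?_, ?_⟩
  · rintro _ ⟨a, rfl⟩
    exact hAU a a.2
  · exact (hρ.domRestrict.subtype_mk _).subtype_mk _
  · intro a h
    exact Subtype.ext (Subtype.ext (hfix a a.2))

lemma isENRSet_cube_top_face {N : ℕ} (k : Fin N) :
    IsENRSet {x : frontier (Icc (0 : Fin N → ℝ) 1) | x.1 k = 1} := by
  refine isENRSet_of_retraction isOpen_univ (fun _ _ => mem_univ _)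
    (fun x i => if i = k then 1 else max 0 (min 1 (x i))) ?_ ?_ ?_
  · refine (continuous_pi fun i => ?_).continuousOn
    split_ifs <;> fun_prop
  · intro x _
    refine ⟨mem_frontier_Icc_zero_one_iff.2 ⟨fun i => ?_, k, by simp⟩, by simp⟩
    split_ifs <;> simp
  · intro a ha
    obtain ⟨h, -⟩ := mem_frontier_Icc_zero_one_iff.1 a.2
    ext i
    split_ifs with hi
    · rw [hi]; exact ha.symm
    · simp [h i]

lemma isENRSet_cube_frontier_compl_top_face {N : ℕ} (k : Fin N) :
    IsENRSet {x : frontier (Icc (0 : Fin N → ℝ) 1) | x.1 k < 1} := by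
  set c : Fin N → ℝ := fun _ => 1 / 2 with hc
  set ρ : (Fin N → ℝ) → (Fin N → ℝ) := fun x => c + (1 / 2 * ‖x - c‖⁻¹) • (x - c) with hρdef
  have hρ : ContinuousOn ρ {c}ᶜ := by
    have : ContinuousOn (fun x : Fin N → ℝ => ‖x - c‖⁻¹) {c}ᶜ :=
      ContinuousOn.inv₀ (by fun_prop) fun x hx => norm_ne_zero_iff.2 (sub_ne_zero.2 hx)
    fun_prop
  have hS : ∀ x : Fin N → ℝ, x ∈ frontier (Icc (0 : Fin N → ℝ) 1) ↔ ‖x - c‖ = 1 / 2 := by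
    intro x
    rw [frontier_Icc_zero_one_eq_sphere, mem_sphere_iff_norm]
  have hfix : ∀ x ∈ frontier (Icc (0 : Fin N → ℝ) 1), ρ x = x := by
    intro x hx
    simp [hρdef, (hS x).1 hx]
  refine isENRSet_of_retraction (U := {c}ᶜ ∩ ρ ⁻¹' {x | x k < 1})
    (hρ.isOpen_inter_preimage isOpen_compl_singleton
      (isOpen_lt (continuous_apply k) continuous_const)) ?_ ρ (hρ.mono inter_subset_left) ?_
    fun a _ => hfix a a.2
  · intro a ha
    refine ⟨?_, ?_⟩
    · rintro h
      have := (hS a).1 a.2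
      rw [mem_singleton_iff.1 h] at this
      norm_num at this
    · rw [mem_preimage, hfix a a.2]
      exact ha
  · rintro x ⟨hx, hxk⟩
    refine ⟨(hS _).2 ?_, hxk⟩
    have : ‖x - c‖ ≠ 0 := norm_ne_zero_iff.2 (sub_ne_zero.2 hx)
    simp [hρdef, norm_smul, this]

lemma Continuous.subtype_val_apply {ι W : Type*} [TopologicalSpace W] {S : Set (ι → ℝ)}
    {f : W → S} (hf : Continuous f) (i : ι) : Continuous fun w => (f w).1 i :=
  (continuous_apply i).comp (continuous_subtype_val.comp hf)

/-- A jointly continuous family of monotone paths from `x₀` to the points of `A`, staying in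
`S`, is a section of the directed evaluation map. -/
lemma catSecSet_of_family {Z : Type*} [TopologicalSpace Z] [Preorder Z] {S : Set Z} {A : Set S}
    {x₀ : S} (G : A → I → Z) (hG : Continuous fun p : A × I => G p.1 p.2)
    (hS : ∀ a t, G a t ∈ S) (hmono : ∀ a, Monotone (G a)) (h0 : ∀ a, G a 0 = x₀)
    (h1 : ∀ a, G a 1 = a.1) : CatSecSet (monoDStruct S) x₀ A :=
  ⟨(ContinuousMap.mk (fun p : A × I => (⟨G p.1 p.2, hS p.1 p.2⟩ : S))
      (hG.subtype_mk _)).curry, ContinuousMap.continuous _,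
    fun a => ⟨hmono a, Subtype.ext (h0 a), Subtype.ext (h1 a)⟩⟩

/-- The top face `x k = 1` is reached by first moving along the `k`-th axis. -/
lemma catSecSet_cube_top_face {n : ℕ} (hn : 1 ≤ n) (k : Fin (n + 1)) :
    CatSecSet (monoDStruct (frontier (Icc (0 : Fin (n + 1) → ℝ) 1)))
      ⟨0, zero_mem_frontier_Icc n⟩ {x | x.1 k = 1} := by
  refine catSecSet_of_family
    (fun x t i => x.1.1 i * if i = k then min 1 (2 * (t : ℝ)) else max 0 (2 * (t : ℝ) - 1))
    ?_ ?_ ?_ ?_ ?_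
  · refine continuous_pi fun i =>
      ((continuous_subtype_val.comp continuous_fst).subtype_val_apply i).mul ?_
    split_ifs <;> fun_prop
  · rintro ⟨x, hx⟩ t
    obtain ⟨h, -⟩ := mem_frontier_Icc_zero_one_iff.1 x.2
    have ht0 := t.2.1
    have ht1 := t.2.2
    refine mem_frontier_Icc_zero_one_iff.2 ⟨fun i => ?_, ?_⟩
    · have hf : 0 ≤ (if i = k then min 1 (2 * (t : ℝ)) else max 0 (2 * (t : ℝ) - 1)) ∧
          (if i = k then min 1 (2 * (t : ℝ)) else max 0 (2 * (t : ℝ) - 1)) ≤ 1 := by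
        split_ifs
        · exact ⟨le_min zero_le_one (by linarith), min_le_left _ _⟩
        · exact ⟨le_max_left _ _, max_le zero_le_one (by linarith)⟩
      exact ⟨mul_nonneg (h i).1 hf.1, mul_le_one₀ (h i).2 hf.1 hf.2⟩
    · rcases le_total (2 * (t : ℝ)) 1 with hle | hle
      · have : Nontrivial (Fin (n + 1)) := Fin.nontrivial_iff_two_le.2 (by omega)
        obtain ⟨i, hi⟩ := exists_ne k
        exact ⟨i, Or.inl (by simp [hi, hle])⟩
      · refine ⟨k, Or.inr ?_⟩
        have hx' : x.1 k = 1 := hx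
        simp [hx', hle]
  · rintro ⟨x, hx⟩ s t hst i
    have hst' : (s : ℝ) ≤ t := hst
    obtain ⟨h, -⟩ := mem_frontier_Icc_zero_one_iff.1 x.2
    refine mul_le_mul_of_nonneg_left ?_ (h i).1
    split_ifs <;> gcongr
  · intro x
    ext i
    simp
  · intro x
    ext i
    have : min (1 : ℝ) 2 = 1 := min_eq_left one_le_two
    norm_num [this]

/-- Off the top face `x k = 1`, a point is reached by moving along the `k`-th axis last. -/
lemma catSecSet_cube_frontier_compl_top_face {n : ℕ} (k : Fin (n + 1)) :
    CatSecSet (monoDStruct (frontier (Icc (0 : Fin (n + 1) → ℝ) 1)))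
      ⟨0, zero_mem_frontier_Icc n⟩ {x | x.1 k < 1} := by
  refine catSecSet_of_family
    (fun x t i => x.1.1 i * if i = k then max 0 (2 * (t : ℝ) - 1) else min 1 (2 * (t : ℝ)))
    ?_ ?_ ?_ ?_ ?_
  · refine continuous_pi fun i =>
      ((continuous_subtype_val.comp continuous_fst).subtype_val_apply i).mul ?_
    split_ifs <;> fun_prop
  · rintro ⟨x, hx⟩ t
    obtain ⟨h, j, hj⟩ := mem_frontier_Icc_zero_one_iff.1 x.2
    have ht0 := t.2.1
    have ht1 := t.2.2
    refine mem_frontier_Icc_zero_one_iff.2 ⟨fun i => ?_, ?_⟩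
    · have hf : 0 ≤ (if i = k then max 0 (2 * (t : ℝ) - 1) else min 1 (2 * (t : ℝ))) ∧
          (if i = k then max 0 (2 * (t : ℝ) - 1) else min 1 (2 * (t : ℝ))) ≤ 1 := by
        split_ifs
        · exact ⟨le_max_left _ _, max_le zero_le_one (by linarith)⟩
        · exact ⟨le_min zero_le_one (by linarith), min_le_left _ _⟩
      exact ⟨mul_nonneg (h i).1 hf.1, mul_le_one₀ (h i).2 hf.1 hf.2⟩
    · rcases le_total (2 * (t : ℝ)) 1 with hle | hle
      · exact ⟨k, Or.inl (by simp [hle])⟩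
      · rcases hj with hj | hj
        · exact ⟨j, Or.inl (by simp [hj])⟩
        · have hjk : j ≠ k := by
            rintro rfl
            exact (ne_of_lt hx) hj
          exact ⟨j, Or.inr (by simp [hj, hjk, hle])⟩
  · rintro ⟨x, hx⟩ s t hst i
    have hst' : (s : ℝ) ≤ t := hst
    obtain ⟨h, -⟩ := mem_frontier_Icc_zero_one_iff.1 x.2
    refine mul_le_mul_of_nonneg_left ?_ (h i).1
    split_ifs <;> gcongr
  · intro x
    ext i
    simp
  · intro x
    ext i
    have : min (1 : ℝ) 2 = 1 := min_eq_left one_le_two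
    norm_num [this]

/-- A directed path on the boundary of the cube from the origin to a point whose only coordinate
equal to `1` is the `j`-th one passes through a point with `j`-th coordinate `1` and some
coordinate `0`. -/
lemma exists_coord_eq_one_and_coord_eq_zero {N : ℕ} {j : Fin N}
    {γ : C(I, frontier (Icc (0 : Fin N → ℝ) 1))} (hγ : Monotone fun t => (γ t).1)
    (h0 : (γ 0).1 = 0) (hj : (γ 1).1 j = 1) (hne : ∀ i ≠ j, (γ 1).1 i < 1) :
    ∃ t, (γ t).1 j = 1 ∧ ∃ i, (γ t).1 i = 0 := by
  have hcl1 : IsClosed {t | (γ t).1 j = 1} := isClosed_eq (γ.continuous.subtype_val_apply j) continuous_const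
  have hcl0 : IsClosed {t | ∃ i, (γ t).1 i = 0} := by
    simp only [ofPred_exists]
    exact isClosed_iUnion_of_finite fun i => isClosed_eq (γ.continuous.subtype_val_apply i) continuous_const
  have hcover : univ ⊆ {t | (γ t).1 j = 1} ∪ {t | ∃ i, (γ t).1 i = 0} := by
    intro t _
    obtain ⟨-, i, hi | hi⟩ := mem_frontier_Icc_zero_one_iff.1 (γ t).2
    · exact Or.inr ⟨i, hi⟩
    · refine Or.inl ?_
      by_cases hij : i = j
      · rwa [hij] at hi
      · exact absurd hi ((hγ (unitInterval.le_one t) i).trans_lt (hne i hij)).ne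
  obtain ⟨t, -, ht⟩ := isPreconnected_closed_iff.1 (isPreconnected_univ (α := I)) _ _ hcl1 hcl0
    hcover ⟨1, mem_univ _, hj⟩ ⟨0, mem_univ _, j, by simp [h0]⟩
  exact ⟨t, ht⟩

/-- The directed sphere admits no global section of the directed evaluation map. -/
lemma not_catSecSet_univ (n : ℕ) :
    ¬ CatSecSet (monoDStruct (frontier (Icc (0 : Fin (n + 1) → ℝ) 1)))
      ⟨0, zero_mem_frontier_Icc n⟩ univ := by
  rintro ⟨s, hs, hsec⟩
  have hmem (j : Fin (n + 1)) (r : I) :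
      (fun i => if i = j then (1 : ℝ) else r) ∈ frontier (Icc (0 : Fin (n + 1) → ℝ) 1) := by
    refine mem_frontier_Icc_zero_one_iff.2 ⟨fun i => ?_, j, by simp⟩
    split_ifs
    · simp
    · exact r.2
  set c : Fin (n + 1) → I → (univ : Set (frontier (Icc (0 : Fin (n + 1) → ℝ) 1))) :=
    fun j r => ⟨⟨_, hmem j r⟩, mem_univ _⟩ with hcdef
  have hc (j) : Continuous (c j) := by
    refine Continuous.subtype_mk (Continuous.subtype_mk (continuous_pi fun i => ?_) _) _
    split_ifs <;> fun_prop
  have hclosed (j) : IsClosed {r | ∃ t, (s (c j r) t).1 j = 1 ∧ ∃ i, (s (c j r) t).1 i = 0} := by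
    have hev : Continuous fun p : I × I => s (c j p.1) p.2 := by
      have := hc j
      fun_prop
    have hcl : IsClosed {p : I × I | (s (c j p.1) p.2).1 j = 1 ∧
        ∃ i, (s (c j p.1) p.2).1 i = 0} := by
      simp only [ofPred_and, ofPred_exists]
      refine (isClosed_eq (hev.subtype_val_apply j) continuous_const).inter ?_
      exact isClosed_iUnion_of_finite fun i => isClosed_eq (hev.subtype_val_apply i) continuous_const
    convert isClosedMap_fst_of_compactSpace _ hcl using 1
    ext r
    simp
  have hone (j) : ∃ t, (s (c j 1) t).1 j = 1 ∧ ∃ i, (s (c j 1) t).1 i = 0 := by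
    refine closure_minimal (s := Ioo (0 : I) 1) (fun r hr => ?_) (hclosed j) ?_
    · refine exists_coord_eq_one_and_coord_eq_zero (hsec _).1 ?_ ?_ fun i hi => ?_
      · rw [(hsec _).2.1]
      · rw [(hsec _).2.2]
        simp [hcdef]
      · rw [(hsec _).2.2]
        simpa [hcdef, hi] using hr.2
    · rw [closure_Ioo zero_ne_one]
      exact right_mem_Icc.2 zero_le_one
  have hc1 (j) : c j 1 = c 0 1 := by
    refine Subtype.ext (Subtype.ext (funext fun i => ?_))
    simp [hcdef]
  simp only [hc1] at hone
  choose t ht1 ht0 using hone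
  obtain ⟨k, hk⟩ := Finite.exists_max t
  obtain ⟨i, hi⟩ := ht0 k
  have := (hsec (c 0 1)).1 (hk i) i
  simp only [ht1, hi] at this
  norm_num at this

/-- The directed sphere `S^n` (`n ≥ 1`), i.e. the boundary of the directed
cube `I⃗^{n+1}` with the d-structure of paths non-decreasing in each coordinate and the
origin as initial point, has directed LS category `2`. -/
theorem vcat_directed_sphere (n : ℕ) (hn : 1 ≤ n) :
    vcat (monoDStruct (frontier (Set.Icc (0 : Fin (n + 1) → ℝ) 1)))
      ⟨0, zero_mem_frontier_Icc n⟩ = 2 := by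
  refine le_antisymm (sInf_le ⟨2, rfl, ![{x | x.1 0 = 1}, {x | x.1 0 < 1}], ?_, fun x => ?_⟩)
    (le_sInf ?_)
  · rw [Fin.forall_fin_two]
    exact ⟨⟨isENRSet_cube_top_face 0, catSecSet_cube_top_face hn 0⟩,
      ⟨isENRSet_cube_frontier_compl_top_face 0, catSecSet_cube_frontier_compl_top_face 0⟩⟩
  · rcases ((mem_frontier_Icc_zero_one_iff.1 x.2).1 0).2.eq_or_lt with h | h
    · exact ⟨0, h⟩
    · exact ⟨1, h⟩
  · rintro _ ⟨m, rfl, U, hU, hcover⟩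
    by_contra! hm
    have hm' : m < 2 := by exact_mod_cast hm
    have : Subsingleton (Fin m) := Fin.subsingleton_iff_le_one.2 (by omega)
    obtain ⟨i, -⟩ := hcover ⟨0, zero_mem_frontier_Icc n⟩
    have huniv : U i = univ := eq_univ_of_forall fun x => by
      obtain ⟨i', hi'⟩ := hcover x
      rwa [Subsingleton.elim i i']
    exact not_catSecSet_univ n (huniv ▸ (hU i).2)
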